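/- Let a₁, a₂ ∈ ℝ² be linearly independent vectors, let Γ := { m·a₁ + n·a₂ : m, n ∈ ℤ } be the lattice they generate, and let Λ₁ := { y₁·a₁ + y₂·a₂ : y₁, y₂ ∈ [−1/2, 1/2] } be the unit cell. Let b ∈ ℝ, let A_per : ℝ² → ℝ² be continuous and Γ-periodic, and set A(x) := (b/2)·(−x₂, x₁) + A_per(x). Let K and V be JCEL kernels, each satisfying the magnetic periodicity condition (mpc) with respect to A and Γ. Define V*(x,x') := conj(V(x',x)), and assume the kernel identity V(x,x') + V*(x,x') + (V ∘ V*)(x,x') = 0 for all x, x' ∈ ℝ² (which expresses U·U* = 1 for U = Id + V). Then ∫_{Λ₁} ( K + V* ∘ K + K ∘ V + V* ∘ (K ∘ V) )(x,x) dx = ∫_{Λ₁} K(x,x) dx. -/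

import Mathlib

open MeasureTheory RealInnerProductSpace

noncomputable section

/-- The Euclidean plane `ℝ²`. -/
abbrev R2 : Type := EuclideanSpace ℝ (Fin 2)

/-- Building a vector in `ℝ²` from its two coordinates. -/
noncomputable def vec2 (s t : ℝ) : R2 := (WithLp.equiv 2 (Fin 2 → ℝ)).symm ![s, t]

/-- The lattice `Γ = ℤa₁ + ℤa₂` generated by `a₁, a₂ ∈ ℝ²`. -/
def lattice (a₁ a₂ : R2) : Set R2 := {γ | ∃ m n : ℤ, γ = m • a₁ + n • a₂}

/-- The unit cell `Λ₁ = { y₁a₁ + y₂a₂ : y₁, y₂ ∈ [−1/2, 1/2] }`. -/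
def unitCell (a₁ a₂ : R2) : Set R2 :=
  {x | ∃ y₁ y₂ : ℝ, y₁ ∈ Set.Icc (-(1/2) : ℝ) (1/2) ∧ y₂ ∈ Set.Icc (-(1/2) : ℝ) (1/2) ∧
    x = y₁ • a₁ + y₂ • a₂}

/-- A kernel `K : ℝ² × ℝ² → ℂ` is *jointly continuous exponentially localized* (JCEL) with
localization constants `(C, β)` if it is jointly continuous and
`|K(x,x')| ≤ C·exp(−β·‖x−x'‖)` for all `x, x'`. -/
def JCEL (K : R2 × R2 → ℂ) (C β : ℝ) : Prop :=
  Continuous K ∧ ∀ x x' : R2, ‖K (x, x')‖ ≤ C * Real.exp (-β * ‖x - x'‖)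

/-- The magnetic periodicity condition (mpc) for a kernel `K` with respect to a vector
potential `A` and a lattice `Γ`. -/
def MPC (A : R2 → R2) (Γ : Set R2) (K : R2 × R2 → ℂ) : Prop :=
  ∀ γ ∈ Γ, ∀ x x' : R2,
    Complex.exp (-Complex.I * (⟪A x, γ⟫ : ℝ)) * K (x - γ, x') =
      K (x, x' + γ) * Complex.exp (-Complex.I * (⟪A (x' + γ), γ⟫ : ℝ))

/-- Composition of kernels: `(K₁ ∘ K₂)(x,x') = ∫ K₁(x,y)·K₂(y,x') dy`. -/
noncomputable def compK (K₁ K₂ : R2 × R2 → ℂ) : R2 × R2 → ℂ :=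
  fun p => ∫ y : R2, K₁ (p.1, y) * K₂ (y, p.2)

/-- The adjoint kernel `V*(x,x') := conj(V(x',x))`. -/
def starK (V : R2 × R2 → ℂ) : R2 × R2 → ℂ := fun p => (starRingEnd ℂ) (V (p.2, p.1))

open Module
open scoped Pointwise

/-- The exponential `y ↦ exp (-β‖y‖)` is integrable on the plane. -/
theorem integrable_exp_neg_mul_norm {β : ℝ} (hβ : 0 < β) :
    Integrable (fun y : R2 => Real.exp (-β * ‖y‖)) := by
  have h3 : Integrable (fun y : R2 => (1 + ‖y‖) ^ (-(3 : ℝ))) :=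
    integrable_one_add_norm (by simp; norm_num)
  refine (h3.const_mul (Real.exp β * 6 / β ^ 3)).mono'
    (by fun_prop : Continuous _).aestronglyMeasurable (.of_forall fun y => ?_)
  rw [Real.norm_eq_abs, abs_of_pos (Real.exp_pos _)]
  have h1 : 0 < 1 + ‖y‖ := by positivity
  have h := Real.pow_div_factorial_le_exp (β * (1 + ‖y‖)) (by positivity) 3
  have h2 : (1 + ‖y‖) ^ (-(3 : ℝ)) = ((1 + ‖y‖) ^ 3)⁻¹ := by
    rw [Real.rpow_neg h1.le]
    norm_cast
  have h6 : (β * (1 + ‖y‖)) ^ 3 ≤ 6 * (Real.exp β * Real.exp (β * ‖y‖)) := by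
    rw [← Real.exp_add, ← mul_one_add]
    norm_num [Nat.factorial] at h
    linarith
  rw [h2, neg_mul, Real.exp_neg, ← div_eq_mul_inv, div_div, ← mul_pow, inv_eq_one_div,
    div_le_div_iff₀ (Real.exp_pos _) (by positivity)]
  linarith

theorem integrable_exp_neg_mul_norm_sub {β : ℝ} (hβ : 0 < β) (x : R2) :
    Integrable (fun y : R2 => Real.exp (-β * ‖x - y‖)) :=
  (integrable_exp_neg_mul_norm hβ).comp_sub_left x

theorem integrable_prod_of_exp_bound {f : R2 × R2 → ℂ} {C β : ℝ} (hβ : 0 < β)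
    (hf : StronglyMeasurable f) (hb : ∀ x y, ‖f (x, y)‖ ≤ C * Real.exp (-β * ‖x - y‖))
    (μ : Measure R2) [IsFiniteMeasure μ] : Integrable f (μ.prod volume) := by
  have hg : Integrable (fun p : R2 × R2 => Real.exp (-β * ‖p.1 - p.2‖)) (μ.prod volume) := by
    rw [integrable_prod_iff (by fun_prop : Continuous _).aestronglyMeasurable]
    refine ⟨.of_forall fun x => integrable_exp_neg_mul_norm_sub hβ x, ?_⟩
    have : ∀ x : R2, ∫ y : R2, ‖Real.exp (-β * ‖x - y‖)‖ = ∫ y : R2, ‖Real.exp (-β * ‖y‖)‖ :=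
      fun x => integral_sub_left_eq_self (fun y : R2 => ‖Real.exp (-β * ‖y‖)‖) volume x
    simp only [this]
    exact integrable_const _
  exact (hg.const_mul C).mono' hf.aestronglyMeasurable (.of_forall fun p => hb p.1 p.2)

/-- Diagonally invariant functions have the same integral over `F × ℝ²` and `ℝ² × F`. -/
theorem setIntegral_prod_univ_eq_univ_prod {L : AddSubgroup R2} [Countable L] {F : Set R2}
    (hF : IsAddFundamentalDomain L F volume) {f : R2 × R2 → ℂ}
    (hf : ∀ γ ∈ L, ∀ x y, f (γ + x, γ + y) = f (x, y)) :
    ∫ p in F ×ˢ (Set.univ : Set R2), f p ∂((volume : Measure R2).prod volume) =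
      ∫ p in (Set.univ : Set R2) ×ˢ F, f p ∂((volume : Measure R2).prod volume) := by
  have : VAddInvariantMeasure L (R2 × R2)
      ((volume : Measure R2).prod volume) := by
    refine ⟨fun c s hs => ?_⟩
    exact ((measurePreserving_add_left (volume : Measure R2) (c : R2)).prod
      (measurePreserving_add_left (volume : Measure R2) (c : R2))).measure_preimage hs.nullMeasurableSet
  have h1 : IsAddFundamentalDomain L (F ×ˢ (Set.univ : Set R2))
      ((volume : Measure R2).prod volume) := by
    rw [Set.prod_univ]
    exact hF.preimage_of_equiv Measure.quasiMeasurePreserving_fst (e := id)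
      Function.bijective_id fun g p => rfl
  have h2 : IsAddFundamentalDomain L ((Set.univ : Set R2) ×ˢ F)
      ((volume : Measure R2).prod volume) := by
    rw [Set.univ_prod]
    exact hF.preimage_of_equiv Measure.quasiMeasurePreserving_snd (e := id)
      Function.bijective_id fun g p => rfl
  exact h1.setIntegral_eq h2 fun g p => hf g g.2 p.1 p.2

/-- The covariance form of the magnetic periodicity condition. -/
def MagneticCovariant (A : R2 → R2) (L : AddSubgroup R2) (K : R2 × R2 → ℂ) : Prop :=
  ∀ γ ∈ L, ∀ x y : R2, K (γ + x, γ + y) =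
    Complex.exp (-Complex.I * (⟪A (γ + x), γ⟫ : ℝ)) * K (x, y) *
      Complex.exp (Complex.I * (⟪A (γ + y), γ⟫ : ℝ))

theorem MPC.magneticCovariant {A : R2 → R2} {Γ : Set R2} {L : AddSubgroup R2}
    (hL : (L : Set R2) ⊆ Γ) {K : R2 × R2 → ℂ} (h : MPC A Γ K) : MagneticCovariant A L K := by
  intro γ hγ x y
  have := h γ (hL hγ) (γ + x) y
  rw [add_sub_cancel_left, add_comm y] at this
  rw [this, mul_assoc, ← Complex.exp_add]
  simp

theorem MagneticCovariant.starK {A : R2 → R2} {L : AddSubgroup R2} {K : R2 × R2 → ℂ}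
    (h : MagneticCovariant A L K) : MagneticCovariant A L (starK K) := by
  intro γ hγ x y
  simp only [_root_.starK, h γ hγ y x, map_mul, ← Complex.exp_conj, map_neg, Complex.conj_I,
    Complex.conj_ofReal, neg_neg]
  ring

theorem exp_neg_I_mul_cancel (t : ℝ) :
    Complex.exp (Complex.I * t) * Complex.exp (-Complex.I * t) = 1 := by
  rw [← Complex.exp_add]
  simp

theorem MagneticCovariant.mul {A : R2 → R2} {L : AddSubgroup R2} {S T : R2 × R2 → ℂ}
    (hS : MagneticCovariant A L S) (hT : MagneticCovariant A L T) {γ : R2} (hγ : γ ∈ L)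
    (x y z : R2) : S (γ + x, γ + y) * T (γ + y, γ + z) =
      Complex.exp (-Complex.I * (⟪A (γ + x), γ⟫ : ℝ)) * (S (x, y) * T (y, z)) *
        Complex.exp (Complex.I * (⟪A (γ + z), γ⟫ : ℝ)) := by
  rw [hS γ hγ, hT γ hγ]
  linear_combination (Complex.exp (-Complex.I * (⟪A (γ + x), γ⟫ : ℝ)) * (S (x, y) * T (y, z)) *
    Complex.exp (Complex.I * (⟪A (γ + z), γ⟫ : ℝ))) * exp_neg_I_mul_cancel ⟪A (γ + y), γ⟫

theorem MagneticCovariant.compK {A : R2 → R2} {L : AddSubgroup R2} {S T : R2 × R2 → ℂ}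
    (hS : MagneticCovariant A L S) (hT : MagneticCovariant A L T) :
    MagneticCovariant A L (compK S T) := by
  intro γ hγ x z
  simp only [_root_.compK]
  rw [← integral_add_left_eq_self _ γ, ← integral_const_mul, ← integral_mul_const]
  exact integral_congr_ae (.of_forall fun y => hS.mul hT hγ x y z)

theorem MagneticCovariant.mul_swap {A : R2 → R2} {L : AddSubgroup R2} {S T : R2 × R2 → ℂ}
    (hS : MagneticCovariant A L S) (hT : MagneticCovariant A L T) {γ : R2} (hγ : γ ∈ L)
    (x y : R2) : S (γ + x, γ + y) * T (γ + y, γ + x) = S (x, y) * T (y, x) := by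
  rw [hS.mul hT hγ]
  linear_combination (S (x, y) * T (y, x)) * exp_neg_I_mul_cancel ⟪A (γ + x), γ⟫

theorem norm_mul_swap_le {S T : R2 × R2 → ℂ} {M C β : ℝ} (hSb : ∀ p, ‖S p‖ ≤ M)
    (hTb : ∀ x y, ‖T (x, y)‖ ≤ C * Real.exp (-β * ‖x - y‖)) (x y : R2) :
    ‖S (x, y) * T (y, x)‖ ≤ M * C * Real.exp (-β * ‖x - y‖) := by
  rw [norm_mul, mul_assoc, norm_sub_rev x y]
  exact mul_le_mul (hSb _) (hTb y x) (norm_nonneg _) ((norm_nonneg _).trans (hSb (x, y)))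

theorem stronglyMeasurable_mul_swap {S T : R2 × R2 → ℂ} (hS : StronglyMeasurable S)
    (hT : StronglyMeasurable T) : StronglyMeasurable fun p : R2 × R2 => S p * T p.swap :=
  hS.mul (hT.comp_measurable measurable_swap)

theorem integrableOn_compK_diag {S T : R2 × R2 → ℂ} {M C β : ℝ} (hβ : 0 < β)
    (hS : StronglyMeasurable S) (hT : StronglyMeasurable T) (hSb : ∀ p, ‖S p‖ ≤ M)
    (hTb : ∀ x y, ‖T (x, y)‖ ≤ C * Real.exp (-β * ‖x - y‖)) {F : Set R2}
    (hF : volume F ≠ ⊤) : IntegrableOn (fun x => compK S T (x, x)) F := by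
  have : IsFiniteMeasure (volume.restrict F) := isFiniteMeasure_restrict.2 hF
  exact (integrable_prod_of_exp_bound hβ (stronglyMeasurable_mul_swap hS hT)
    (norm_mul_swap_le hSb hTb) (volume.restrict F)).integral_prod_left

theorem compK_diag_swap_eq (S T : R2 × R2 → ℂ) (x : R2) :
    compK T S (x, x) = ∫ y, S (y, x) * T (x, y) := by
  simp only [compK, mul_comm]

/-- Cyclicity of the diagonal integral over a fundamental domain. -/
theorem setIntegral_compK_comm {A : R2 → R2} {L : AddSubgroup R2} [Countable L] {F : Set R2}
    (hF : IsAddFundamentalDomain L F volume) (hFfin : volume F ≠ ⊤)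
    {S T : R2 × R2 → ℂ} {M C β : ℝ} (hβ : 0 < β)
    (hS : StronglyMeasurable S) (hT : StronglyMeasurable T) (hSb : ∀ p, ‖S p‖ ≤ M)
    (hTb : ∀ x y, ‖T (x, y)‖ ≤ C * Real.exp (-β * ‖x - y‖))
    (hSc : MagneticCovariant A L S) (hTc : MagneticCovariant A L T) :
    IntegrableOn (fun x => compK T S (x, x)) F ∧
    ∫ x in F, compK S T (x, x) = ∫ x in F, compK T S (x, x) := by
  have : IsFiniteMeasure (volume.restrict F) := isFiniteMeasure_restrict.2 hFfin
  set f : R2 × R2 → ℂ := fun p => S p * T p.swap with hfdef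
  have hfm : StronglyMeasurable f := stronglyMeasurable_mul_swap hS hT
  have hfb := norm_mul_swap_le hSb hTb
  have h1 : Integrable f ((volume.restrict F).prod volume) :=
    integrable_prod_of_exp_bound hβ hfm hfb _
  have h2 : Integrable (fun p => f p.swap) ((volume.restrict F).prod volume) :=
    integrable_prod_of_exp_bound hβ (hfm.comp_measurable measurable_swap)
      (fun x y => (hfb y x).trans_eq (by rw [norm_sub_rev])) _
  have hsw := setIntegral_prod_univ_eq_univ_prod hF (f := f)
    fun γ hγ x y => hSc.mul_swap hTc hγ x y
  rw [← Measure.prod_restrict, ← Measure.prod_restrict, Measure.restrict_univ, integral_prod f h1,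
    ← integral_prod_swap, integral_prod _ h2] at hsw
  have hcomm : (fun x => compK T S (x, x)) = fun x => ∫ y, f (Prod.swap (x, y)) := by
    funext x
    exact compK_diag_swap_eq S T x
  rw [hcomm]
  exact ⟨h2.integral_prod_left, hsw⟩

theorem stronglyMeasurable_compK {S T : R2 × R2 → ℂ} (hS : StronglyMeasurable S)
    (hT : StronglyMeasurable T) : StronglyMeasurable (compK S T) := by
  refine StronglyMeasurable.integral_prod_right'
    (f := fun q : (R2 × R2) × R2 => S (q.1.1, q.2) * T (q.2, q.1.2)) ?_
  exact (hS.comp_measurable (by fun_prop)).mul (hT.comp_measurable (by fun_prop))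

theorem JCEL.norm_le {K : R2 × R2 → ℂ} {C β : ℝ} (h : JCEL K C β) (hC : 0 < C) (hβ : 0 < β)
    (p : R2 × R2) : ‖K p‖ ≤ C := by
  refine (h.2 p.1 p.2).trans (mul_le_of_le_one_right hC.le (Real.exp_le_one_iff.2 ?_))
  have := mul_nonneg hβ.le (norm_nonneg (p.1 - p.2))
  linarith

theorem JCEL.stronglyMeasurable {K : R2 × R2 → ℂ} {C β : ℝ} (h : JCEL K C β) :
    StronglyMeasurable K := h.1.stronglyMeasurable

theorem JCEL.starK {K : R2 × R2 → ℂ} {C β : ℝ} (h : JCEL K C β) : JCEL (starK K) C β := by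
  refine ⟨Complex.continuous_conj.comp (h.1.comp continuous_swap), fun x y => ?_⟩
  rw [norm_sub_rev]
  exact (RCLike.norm_conj _).trans_le (h.2 y x)

theorem JCEL.integrable_left {K : R2 × R2 → ℂ} {C β : ℝ} (h : JCEL K C β) (hβ : 0 < β)
    (x : R2) : Integrable fun y => K (x, y) :=
  ((integrable_exp_neg_mul_norm_sub hβ x).const_mul C).mono'
    (h.1.comp (by fun_prop)).aestronglyMeasurable (.of_forall fun y => h.2 x y)

theorem JCEL.integrable_right {K : R2 × R2 → ℂ} {C β : ℝ} (h : JCEL K C β) (hβ : 0 < β)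
    (x : R2) : Integrable fun y => K (y, x) := by
  refine ((integrable_exp_neg_mul_norm_sub hβ x).const_mul C).mono'
    (h.1.comp (by fun_prop)).aestronglyMeasurable (.of_forall fun y => ?_)
  rw [norm_sub_rev]
  exact h.2 y x

theorem JCEL.integrable_mul {K V : R2 × R2 → ℂ} {C β C' β' : ℝ} (hK : JCEL K C β)
    (hV : JCEL V C' β') (hβ : 0 < β) (hC' : 0 < C') (hβ' : 0 < β') (x z : R2) :
    Integrable fun y => K (x, y) * V (y, z) :=
  (hK.integrable_left hβ x).mul_bdd (c := C')
    (hV.1.comp (by fun_prop)).aestronglyMeasurable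
    (.of_forall fun y => hV.norm_le hC' hβ' (y, z))

theorem JCEL.exists_norm_compK_le {K V : R2 × R2 → ℂ} {C β C' β' : ℝ} (hK : JCEL K C β)
    (hV : JCEL V C' β') (hC : 0 < C) (hβ : 0 < β) (hC' : 0 < C') (hβ' : 0 < β') :
    ∃ M, ∀ p, ‖compK K V p‖ ≤ M := by
  refine ⟨∫ y : R2, C * Real.exp (-β * ‖y‖) * C', fun p => ?_⟩
  rw [← integral_sub_left_eq_self (fun y : R2 => C * Real.exp (-β * ‖y‖) * C') volume p.1]
  refine norm_integral_le_of_norm_le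
    (((integrable_exp_neg_mul_norm_sub hβ p.1).const_mul C).mul_const C')
    (.of_forall fun y => ?_)
  rw [norm_mul]
  exact mul_le_mul (hK.2 _ _) (hV.norm_le hC' hβ' _) (norm_nonneg _) (by positivity)

/-- Associativity of the composition of exponentially localized kernels. -/
theorem JCEL.compK_assoc {K V W : R2 × R2 → ℂ} {C β C' β' C'' β'' : ℝ} (hK : JCEL K C β)
    (hV : JCEL V C' β') (hW : JCEL W C'' β'') (hβ : 0 < β) (hC' : 0 < C') (hβ' : 0 < β')
    (hβ'' : 0 < β'') (p : R2 × R2) :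
    compK (compK K V) W p = compK K (compK V W) p := by
  obtain ⟨x, x'⟩ := p
  have hint : Integrable (fun q : R2 × R2 => V (q.2, q.1) * (W (q.1, x') * K (x, q.2)))
      (volume.prod volume) := by
    refine ((hW.integrable_right hβ'' x').mul_prod (hK.integrable_left hβ x)).bdd_mul (c := C')
      (hV.1.comp (by fun_prop)).aestronglyMeasurable
      (.of_forall fun q => hV.norm_le hC' hβ' (q.2, q.1))
  simp only [compK, ← integral_mul_const, ← integral_const_mul]
  have h := integral_integral_swap (μ := volume) (ν := volume)
    (f := fun y z : R2 => V (z, y) * (W (y, x') * K (x, z))) hint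
  refine (Eq.trans ?_ h).trans ?_ <;>
    refine integral_congr_ae (.of_forall fun y => integral_congr_ae (.of_forall fun z => ?_)) <;>
    dsimp only <;> ring

theorem unitCell_ae_eq_vadd_fundamentalDomain {a₁ a₂ : R2} (B : Basis (Fin 2) ℝ R2)
    (hB : ⇑B = ![a₁, a₂]) :
    unitCell a₁ a₂ =ᵐ[volume]
      ((-(1 / 2 : ℝ) • (a₁ + a₂)) +ᵥ ZSpan.fundamentalDomain B : Set R2) := by
  have h : unitCell a₁ a₂ = (-(1 / 2 : ℝ) • (a₁ + a₂)) +ᵥ parallelepiped B := by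
    ext x
    rw [Set.mem_vadd_set_iff_neg_vadd_mem, mem_parallelepiped_iff, hB]
    constructor
    · rintro ⟨s, t, hs, ht, rfl⟩
      refine ⟨![s + 1 / 2, t + 1 / 2], ?_, ?_⟩
      · simp only [Set.mem_Icc, Pi.le_def, Fin.forall_fin_two] at hs ht ⊢
        simp
        constructor <;> constructor <;> linarith
      · simp [Fin.sum_univ_two]
        module
    · rintro ⟨t, ht, hx⟩
      simp only [Set.mem_Icc, Pi.le_def, Fin.forall_fin_two, Pi.zero_apply, Pi.one_apply] at ht
      refine ⟨t 0 - 1 / 2, t 1 - 1 / 2, ⟨by linarith, by linarith⟩, ⟨by linarith, by linarith⟩, ?_⟩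
      simp only [vadd_eq_add, Fin.sum_univ_two, Matrix.cons_val_zero, Matrix.cons_val_one] at hx
      rw [neg_add_eq_iff_eq_add] at hx
      rw [hx]
      module
  rw [h]
  exact (vadd_set_ae_eq _).2 (ZSpan.fundamentalDomain_ae_parallelepiped B volume).symm

/-- Proposition C.4. The trace per unit area is invariant under
conjugation by a magnetic periodic unitary `U = Id + V` with `V` JCEL: if
`V + V* + V∘V* = 0` (i.e. `U·U* = 1`), then the diagonal integral over the unit cell of the
kernel of `U⁻¹TU = (Id+V)*·T·(Id+V)`, namely `K + V*∘K + K∘V + V*∘(K∘V)`, equals that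
of `K`. -/
theorem stmt_10 (a₁ a₂ : R2) (hlin : LinearIndependent ℝ ![a₁, a₂])
    (b : ℝ) (Aper : R2 → R2) (hAper : Continuous Aper)
    (hAperiodic : ∀ γ ∈ lattice a₁ a₂, ∀ x : R2, Aper (x + γ) = Aper x)
    (A : R2 → R2) (hA : A = fun x => (b/2) • vec2 (-(x 1)) (x 0) + Aper x)
    (K V : R2 × R2 → ℂ) (CK βK CV βV : ℝ)
    (hCK : 0 < CK) (hβK : 0 < βK) (hCV : 0 < CV) (hβV : 0 < βV)
    (hK : JCEL K CK βK) (hV : JCEL V CV βV)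
    (hKmpc : MPC A (lattice a₁ a₂) K) (hVmpc : MPC A (lattice a₁ a₂) V)
    (hunit : ∀ p : R2 × R2, V p + starK V p + compK V (starK V) p = 0) :
    ∫ x in unitCell a₁ a₂,
        (K (x, x) + compK (starK V) K (x, x) + compK K V (x, x) +
          compK (starK V) (compK K V) (x, x)) =
      ∫ x in unitCell a₁ a₂, K (x, x) := by
  let B : Basis (Fin 2) ℝ R2 := basisOfLinearIndependentOfCardEqFinrank hlin (by simp)
  have hB : ⇑B = ![a₁, a₂] := coe_basisOfLinearIndependentOfCardEqFinrank _ _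
  let L : AddSubgroup R2 := (Submodule.span ℤ (Set.range B)).toAddSubgroup
  have hL : (L : Set R2) ⊆ lattice a₁ a₂ := by
    intro γ hγ
    have hγ' : γ ∈ Submodule.span ℤ (Set.range B) := hγ
    rw [hB, Matrix.range_cons, Matrix.range_cons, Matrix.range_empty, Set.union_empty,
      Set.singleton_union, Submodule.mem_span_pair] at hγ'
    obtain ⟨m, n, h⟩ := hγ'
    exact ⟨m, n, h.symm⟩
  have : Countable L := inferInstanceAs (Countable (Submodule.span ℤ (Set.range B)))
  set F : Set R2 := (-(1 / 2 : ℝ) • (a₁ + a₂)) +ᵥ ZSpan.fundamentalDomain B with hFdef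
  have hF : IsAddFundamentalDomain L F volume :=
    (ZSpan.isAddFundamentalDomain' B volume).vadd_of_comm _
  have hFfin : volume F ≠ ⊤ := by
    rw [hFdef, measure_vadd]
    exact (ZSpan.fundamentalDomain_isBounded B).measure_lt_top.ne
  rw [Measure.restrict_congr_set (unitCell_ae_eq_vadd_fundamentalDomain B hB), ← hFdef]
  have hKc := hKmpc.magneticCovariant hL
  have hVc := hVmpc.magneticCovariant hL
  have hVs := hV.starK
  obtain ⟨M, hM⟩ := hK.exists_norm_compK_le hV hCK hβK hCV hβV
  have hKVm := stronglyMeasurable_compK hK.stronglyMeasurable hV.stronglyMeasurable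
  have : IsFiniteMeasure (volume.restrict F) := isFiniteMeasure_restrict.2 hFfin
  have hiK : IntegrableOn (fun x => K (x, x)) F :=
    Integrable.of_bound (hK.1.comp (by fun_prop)).aestronglyMeasurable CK
      (.of_forall fun x => hK.norm_le hCK hβK (x, x))
  have hiKV := integrableOn_compK_diag hβV hK.stronglyMeasurable hV.stronglyMeasurable
    (hK.norm_le hCK hβK) hV.2 hFfin
  have hiKVs := integrableOn_compK_diag hβV hK.stronglyMeasurable hVs.stronglyMeasurable
    (hK.norm_le hCK hβK) hVs.2 hFfin
  obtain ⟨hiVsK, e1⟩ := setIntegral_compK_comm hF hFfin hβV hK.stronglyMeasurable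
    hVs.stronglyMeasurable (hK.norm_le hCK hβK) hVs.2 hKc hVc.starK
  obtain ⟨hiVsKV, e2⟩ := setIntegral_compK_comm hF hFfin hβV hKVm
    hVs.stronglyMeasurable hM hVs.2 (hKc.compK hVc) hVc.starK
  have e3 : ∀ x, compK (compK K V) (starK V) (x, x) =
      -(compK K V (x, x) + compK K (starK V) (x, x)) := by
    intro x
    rw [hK.compK_assoc hV hVs hβK hCV hβV hβV]
    simp only [compK]
    rw [← integral_add (hK.integrable_mul hV hβK hCV hβV x x)
      (hK.integrable_mul hVs hβK hCV hβV x x), ← integral_neg]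
    refine integral_congr_ae (.of_forall fun y => ?_)
    have h := hunit (y, x)
    simp only [compK] at h
    linear_combination K (x, y) * h
  simp only [e3] at e2
  rw [integral_neg, integral_add hiKV hiKVs] at e2
  rw [integral_add (by exact (hiK.add hiVsK).add hiKV) hiVsKV,
    integral_add (by exact hiK.add hiVsK) hiKV, integral_add hiK hiVsK]
  linear_combination -e1 - e2
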